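/- Suppose μ is doubling. Let ρ₁, ρ₂ be σ-finite Borel measures on M, finite on every ball and outer regular on Borel sets, and for each open ball B let ν_B denote the finite signed measure (ρ₁ − ρ₂) restricted to B, with ⟨ν⟩_B = (ρ₁(B) − ρ₂(B))/μ(B). Assume K := sup_B (1/μ(B))·|ν_B − ⟨ν⟩_B·μ|(B) < ∞, the supremum being over all open balls B. Then there exists a locally μ-integrable function f : M → ℝ such that ρ₁(E) − ρ₂(E) = ∫_E f dμ for every bounded Borel set E, and sup_B (1/μ(B))·∫_B |f − ⟨f⟩_B| dμ = K, where ⟨f⟩_B is the average of f over B. -/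

import Mathlib

open MeasureTheory Metric ENNReal

/-- The finite signed measure obtained by restricting the measure `ρ` to the set `B`
(defined when `ρ B < ∞`; junk value `0` otherwise). -/
noncomputable def restrictSM {M : Type*} [MeasurableSpace M]
    (ρ : MeasureTheory.Measure M) (B : Set M) : MeasureTheory.SignedMeasure M :=
  if h : ρ B < ⊤ then
    haveI : MeasureTheory.IsFiniteMeasure (ρ.restrict B) :=
      ⟨by simpa [MeasureTheory.Measure.restrict_apply_univ] using h⟩
    (ρ.restrict B).toSignedMeasure
  else 0

/-- On a ball of finite measure, `restrictSM` evaluates to the measure of the intersection. -/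
theorem restrictSM_apply {M : Type*} [MeasurableSpace M] {ρ : Measure M} {B A : Set M}
    (hB : ρ B < ⊤) (hA : MeasurableSet A) :
    restrictSM ρ B A = ρ.real (A ∩ B) := by
  have : IsFiniteMeasure (ρ.restrict B) :=
    ⟨by simpa [Measure.restrict_apply_univ] using hB⟩
  rw [restrictSM, dif_pos hB, Measure.toSignedMeasure_apply_measurable hA,
    measureReal_restrict_apply hA]

/-- If `μ` is doubling and `σ` is dominated by a multiple of `μ` on balls, then bounded `μ`-null
sets are `σ`-null. -/
theorem measure_null_of_ball_le {M : Type*} [PseudoMetricSpace M] [MeasurableSpace M]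
    [BorelSpace M] {μ σ : Measure M}
    (hμ : ∀ (x : M) (r : ℝ), 0 < r → 0 < μ (ball x r) ∧ μ (ball x r) < ⊤)
    {D : ℝ≥0∞} (hD : D ≠ ⊤)
    (hdoub : ∀ (x : M) (r : ℝ), 0 < r → μ (ball x (2 * r)) ≤ D * μ (ball x r))
    {C : ℝ≥0∞} (hC : C ≠ ⊤)
    (hσ : ∀ (x : M) (r : ℝ), 0 < r → σ (ball x r) ≤ C * μ (ball x r))
    {E : Set M} (hE : Bornology.IsBounded E) (hE0 : μ E = 0) : σ E = 0 := by
  rcases E.eq_empty_or_nonempty with rfl | ⟨x₀, -⟩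
  · simp
  obtain ⟨R, hR, hER⟩ := hE.subset_ball_lt 0 x₀
  have : IsFiniteMeasure (μ.restrict (ball x₀ R)) :=
    ⟨by simpa [Measure.restrict_apply_univ] using (hμ x₀ R hR).2⟩
  have hrE : μ.restrict (ball x₀ R) E = 0 :=
    le_antisymm ((Measure.restrict_le_self E).trans hE0.le) zero_le
  have hCD : C * D ^ 3 ≠ ⊤ := by finiteness
  suffices h : ∀ ε : ℝ≥0∞, 0 < ε → σ E ≤ C * D ^ 3 * ε by
    have ht : Filter.Tendsto (fun ε : ℝ≥0∞ => C * D ^ 3 * ε) (nhdsWithin 0 (Set.Ioi 0))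
        (nhds (C * D ^ 3 * 0)) :=
      (ENNReal.Tendsto.const_mul Filter.tendsto_id (Or.inr hCD)).mono_left nhdsWithin_le_nhds
    have := ge_of_tendsto ht (Filter.eventually_of_mem self_mem_nhdsWithin h)
    simpa using this
  intro ε hε
  obtain ⟨U, hEU, hUo, hU⟩ := E.exists_isOpen_lt_of_lt (μ := μ.restrict (ball x₀ R)) ε
    (by rwa [hrE])
  rw [Measure.restrict_apply hUo.measurableSet] at hU
  have hex : ∀ a ∈ E, ∃ r : ℝ, 0 < r ∧ r ≤ 1 ∧ closedBall a r ⊆ U ∩ ball x₀ R := by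
    intro a ha
    obtain ⟨r, hr, hsub⟩ := Metric.nhds_basis_closedBall.mem_iff.1
      ((hUo.inter isOpen_ball).mem_nhds ⟨hEU ha, hER ha⟩)
    exact ⟨min r 1, lt_min hr one_pos, min_le_right _ _,
      (closedBall_subset_closedBall (min_le_left _ _)).trans hsub⟩
  choose! r hr0 hr1 hrsub using hex
  obtain ⟨u, huE, hudisj, hucov⟩ := Vitali.exists_disjoint_subfamily_covering_enlargement_closedBall
    E id r 1 hr1 4 (by norm_num)
  simp only [id] at hudisj hucov
  have hpos : ∀ b ∈ u, 0 < μ (closedBall b (r b)) := fun b hb =>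
    (hμ b _ (hr0 b (huE hb))).1.trans_le (measure_mono ball_subset_closedBall)
  have hsubV : (⋃ b ∈ u, closedBall b (r b)) ⊆ U ∩ ball x₀ R :=
    Set.iUnion₂_subset fun b hb => hrsub b (huE hb)
  have hucount : u.Countable := by
    have hcount := Measure.countable_meas_pos_of_disjoint_of_meas_iUnion_ne_top μ
      (As := fun b : u => closedBall (b : M) (r b)) (fun _ => isClosed_closedBall.measurableSet)
      (fun a b hab => hudisj a.2 b.2 (fun h => hab (Subtype.ext h)))
      (by
        rw [← Set.biUnion_eq_iUnion u (fun b _ => closedBall b (r b))]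
        exact ((measure_mono hsubV).trans_lt hU).ne_top)
    have huniv : {b : u | 0 < μ (closedBall (b : M) (r b))} = Set.univ :=
      Set.eq_univ_of_forall fun b => hpos b b.2
    rw [huniv, Set.countable_univ_iff] at hcount
    exact Set.countable_coe_iff.1 hcount
  have hball : ∀ b ∈ u, σ (ball b (8 * r b)) ≤ C * D ^ 3 * μ (closedBall b (r b)) := by
    intro b hb
    have hb0 := hr0 b (huE hb)
    calc σ (ball b (8 * r b)) ≤ C * μ (ball b (2 * (2 * (2 * r b)))) := by
          convert hσ b (8 * r b) (by positivity) using 4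
          ring
      _ ≤ C * (D * (D * (D * μ (ball b (r b))))) := by
          gcongr
          refine (hdoub b _ (by positivity)).trans ?_
          gcongr
          refine (hdoub b _ (by positivity)).trans ?_
          gcongr
          exact hdoub b _ hb0
      _ = C * D ^ 3 * μ (ball b (r b)) := by ring
      _ ≤ C * D ^ 3 * μ (closedBall b (r b)) := by
          gcongr
          exact ball_subset_closedBall
  have hcover : E ⊆ ⋃ b ∈ u, ball b (8 * r b) := by
    intro a ha
    obtain ⟨b, hb, hab⟩ := hucov a ha
    have hb0 := hr0 b (huE hb)
    exact Set.mem_biUnion hb (closedBall_subset_ball (by linarith)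
      (hab (mem_closedBall_self (hr0 a ha).le)))
  calc σ E ≤ σ (⋃ b ∈ u, ball b (8 * r b)) := measure_mono hcover
    _ ≤ ∑' b : u, σ (ball (b : M) (8 * r b)) := measure_biUnion_le σ hucount _
    _ ≤ ∑' b : u, C * D ^ 3 * μ (closedBall (b : M) (r b)) :=
        ENNReal.tsum_le_tsum fun b => hball b b.2
    _ = C * D ^ 3 * μ (⋃ b ∈ u, closedBall b (r b)) := by
        rw [ENNReal.tsum_mul_left,
          measure_biUnion hucount hudisj fun _ _ => isClosed_closedBall.measurableSet]
    _ ≤ C * D ^ 3 * ε := by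
        gcongr
        exact (measure_mono hsubV).trans hU.le

/-- If `μ` is doubling and `ρ₁` exceeds `ρ₂` on `μ`-null subsets of balls by at most a multiple of
the `μ`-measure of the ball, then `ρ₁ ≤ ρ₂` on bounded `μ`-null sets. -/
theorem measure_le_of_null_of_ball_le {M : Type*} [PseudoMetricSpace M] [MeasurableSpace M]
    [BorelSpace M] {μ ρ₁ ρ₂ : Measure M}
    (hμ : ∀ (x : M) (r : ℝ), 0 < r → 0 < μ (ball x r) ∧ μ (ball x r) < ⊤)
    {D : ℝ≥0∞} (hD : D ≠ ⊤)
    (hdoub : ∀ (x : M) (r : ℝ), 0 < r → μ (ball x (2 * r)) ≤ D * μ (ball x r))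
    {C : ℝ≥0∞} (hC : C ≠ ⊤)
    (hosc : ∀ (x : M) (r : ℝ), 0 < r → ∀ A, MeasurableSet A → A ⊆ ball x r → μ A = 0 →
      ρ₁ A ≤ C * μ (ball x r) + ρ₂ A)
    {E : Set M} (hEm : MeasurableSet E) (hE : Bornology.IsBounded E) (hE0 : μ E = 0)
    (h₁ : ρ₁ E < ⊤) (h₂ : ρ₂ E < ⊤) : ρ₁ E ≤ ρ₂ E := by
  have : IsFiniteMeasure (ρ₁.restrict E) :=
    ⟨by simpa [Measure.restrict_apply_univ] using h₁⟩
  have : IsFiniteMeasure (ρ₂.restrict E) :=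
    ⟨by simpa [Measure.restrict_apply_univ] using h₂⟩
  obtain ⟨S, hS, hSle, hSge⟩ := hahn_decomposition (ρ₁.restrict E) (ρ₂.restrict E)
  have hle : (ρ₂.restrict E).restrict S ≤ (ρ₁.restrict E).restrict S := by
    refine Measure.le_iff.2 fun t ht => ?_
    rw [Measure.restrict_apply ht, Measure.restrict_apply ht]
    exact hSle _ (ht.inter hS) Set.inter_subset_right
  have hsub := Measure.sub_add_cancel_of_le hle
  set σ := (ρ₁.restrict E).restrict S - (ρ₂.restrict E).restrict S
  have hσ_apply : ∀ t, MeasurableSet t → σ t + ρ₂ (t ∩ S ∩ E) = ρ₁ (t ∩ S ∩ E) := by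
    intro t ht
    have := congrArg (fun m : Measure M => m t) hsub
    simpa [Measure.restrict_apply ht, Measure.restrict_apply (ht.inter hS)] using this
  have hσE : σ E = 0 := by
    refine measure_null_of_ball_le hμ hD hdoub hC (fun x r hr => ?_) hE hE0
    have hfin : ρ₂ (ball x r ∩ S ∩ E) ≠ ⊤ :=
      ((measure_mono Set.inter_subset_right).trans_lt h₂).ne
    have hb := hosc x r hr (ball x r ∩ S ∩ E) ((measurableSet_ball.inter hS).inter hEm)
      (Set.inter_subset_left.trans Set.inter_subset_left)
      (measure_mono_null Set.inter_subset_right hE0)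
    rw [← hσ_apply _ measurableSet_ball] at hb
    exact (ENNReal.add_le_add_iff_right hfin).1 hb
  have hS_eq : ρ₁ (E ∩ S) = ρ₂ (E ∩ S) := by
    have := hσ_apply E hEm
    rw [hσE, zero_add, Set.inter_right_comm, Set.inter_self] at this
    exact this.symm
  have hSc_le : ρ₁ (E \ S) ≤ ρ₂ (E \ S) := by
    have := hSge (E \ S) (hEm.diff hS) (fun _ hx => hx.2)
    rwa [Measure.restrict_apply (hEm.diff hS), Measure.restrict_apply (hEm.diff hS),
      Set.inter_eq_left.2 Set.sdiff_subset] at this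
  rw [← measure_inter_add_sdiff E hS, ← measure_inter_add_sdiff (μ := ρ₂) E hS, hS_eq]
  gcongr

/-- If `ρ₁` and `ρ₂` agree on the `μ`-null subsets of a set `E` of finite measure, then `ρ₁ - ρ₂`
is given on `E` by integrating the difference of the Radon-Nikodym derivatives. -/
theorem measureReal_sub_eq_setIntegral_rnDeriv_sub {M : Type*} [MeasurableSpace M]
    {μ ρ₁ ρ₂ : Measure M} [SigmaFinite μ] [SigmaFinite ρ₁] [SigmaFinite ρ₂]
    {E : Set M} (hEm : MeasurableSet E) (h₁ : ρ₁ E ≠ ⊤) (h₂ : ρ₂ E ≠ ⊤)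
    (hnull : ∀ A, MeasurableSet A → A ⊆ E → μ A = 0 → ρ₁ A = ρ₂ A) :
    ρ₁.real E - ρ₂.real E
      = ∫ x in E, ((ρ₁.rnDeriv μ x).toReal - (ρ₂.rnDeriv μ x).toReal) ∂μ := by
  have hs₁ := Measure.mutuallySingular_singularPart ρ₁ μ
  have hs₂ := Measure.mutuallySingular_singularPart ρ₂ μ
  set N := hs₁.nullSetᶜ ∪ hs₂.nullSetᶜ
  have hNm : MeasurableSet N :=
    hs₁.measurableSet_nullSet.compl.union hs₂.measurableSet_nullSet.compl
  have hN0 : μ N = 0 := measure_union_null hs₁.measure_compl_nullSet hs₂.measure_compl_nullSet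
  have key : ∀ ρ : Measure M, SigmaFinite ρ → ρ E ≠ ⊤ → ρ.singularPart μ Nᶜ = 0 →
      ρ.real E = ρ.real (E ∩ N) + ∫ x in E, (ρ.rnDeriv μ x).toReal ∂μ := by
    intro ρ _ hρ hsing
    have hdec : ∀ t, ρ t = ρ.singularPart μ t + μ.withDensity (ρ.rnDeriv μ) t := fun t => by
      rw [← Measure.add_apply, Measure.singularPart_add_rnDeriv]
    have hsE : ρ.singularPart μ E = ρ (E ∩ N) := by
      rw [hdec (E ∩ N), withDensity_absolutelyContinuous μ _
        (measure_mono_null Set.inter_subset_right hN0), add_zero]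
      exact (measure_inter_conull' (measure_mono_null (fun _ hx => hx.2) hsing)).symm
    have hd : μ.withDensity (ρ.rnDeriv μ) E ≠ ⊤ :=
      ne_top_of_le_ne_top hρ (Measure.withDensity_rnDeriv_le ρ μ E)
    rw [Measure.setIntegral_toReal_rnDeriv_eq_withDensity, measureReal_def, hdec E, hsE,
      ENNReal.toReal_add (ne_top_of_le_ne_top hρ (measure_mono Set.inter_subset_left)) hd]
    rfl
  rw [integral_sub (Measure.integrableOn_toReal_rnDeriv h₁)
      (Measure.integrableOn_toReal_rnDeriv h₂),
    key ρ₁ inferInstance h₁ (measure_mono_null (fun x hx => ?_) hs₁.measure_nullSet),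
    key ρ₂ inferInstance h₂ (measure_mono_null (fun x hx => ?_) hs₂.measure_nullSet),
    measureReal_def, measureReal_def,
    hnull (E ∩ N) (hEm.inter hNm) Set.inter_subset_left
      (measure_mono_null Set.inter_subset_right hN0)]
  · ring
  · by_contra h
    exact hx (Or.inr h)
  · by_contra h
    exact hx (Or.inl h)

/-- A measure finite on balls is σ-finite. -/
theorem sigmaFinite_of_ball_lt_top {M : Type*} [PseudoMetricSpace M] [MeasurableSpace M]
    {μ : Measure M} (hμ : ∀ (x : M) (r : ℝ), 0 < r → μ (ball x r) < ⊤) : SigmaFinite μ := by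
  rcases isEmpty_or_nonempty M with h | ⟨⟨x₀⟩⟩
  · rw [Measure.eq_zero_of_isEmpty μ]
    infer_instance
  · exact ⟨⟨{ set := fun n => ball x₀ (n + 1)
              set_mem := fun _ => trivial
              finite := fun n => hμ x₀ _ (by positivity)
              spanning := Set.eq_univ_of_forall fun x => by
                obtain ⟨n, hn⟩ := exists_nat_gt (dist x x₀)
                exact Set.mem_iUnion.2 ⟨n, mem_ball.2 (by linarith)⟩ }⟩⟩

/-- Suppose `μ` is doubling. If the ballwise-finite signed measure
`ν = ρ₁ − ρ₂` (with `ρ₁, ρ₂` σ-finite, outer regular, finite on balls) has finite BMO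
norm `K = sup_B |ν_B − ⟨ν⟩_B·μ|(B)/μ(B)`, then `ν = f·μ` for some locally integrable `f`
with `‖f‖_{BMO} = K`. -/
theorem stmt5 {M : Type*} [MetricSpace M] [MeasurableSpace M] [BorelSpace M]
    (μ ρ₁ ρ₂ : Measure M) [SigmaFinite ρ₁] [SigmaFinite ρ₂]
    [ρ₁.OuterRegular] [ρ₂.OuterRegular]
    (hμ : ∀ (x : M) (r : ℝ), 0 < r → 0 < μ (ball x r) ∧ μ (ball x r) < ⊤)
    (D : ℝ) (hD : 1 ≤ D)
    (hdoub : ∀ (x : M) (r : ℝ), 0 < r →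
      μ (ball x (2 * r)) ≤ ENNReal.ofReal D * μ (ball x r))
    (hρ₁ : ∀ (x : M) (r : ℝ), 0 < r → ρ₁ (ball x r) < ⊤)
    (hρ₂ : ∀ (x : M) (r : ℝ), 0 < r → ρ₂ (ball x r) < ⊤)
    (K : ℝ≥0∞) (hKfin : K ≠ ⊤)
    (hK : K = ⨆ (x : M) (r : ℝ) (_ : 0 < r),
      (((restrictSM ρ₁ (ball x r) - restrictSM ρ₂ (ball x r))
          - (((ρ₁ (ball x r)).toReal - (ρ₂ (ball x r)).toReal) / (μ (ball x r)).toReal) •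
              restrictSM μ (ball x r)).totalVariation (ball x r)) / μ (ball x r)) :
    ∃ f : M → ℝ, MeasureTheory.LocallyIntegrable f μ ∧
      (∀ E : Set M, MeasurableSet E → Bornology.IsBounded E →
        (ρ₁ E).toReal - (ρ₂ E).toReal = ∫ x in E, f x ∂μ) ∧
      (⨆ (x : M) (r : ℝ) (_ : 0 < r),
        ENNReal.ofReal (∫ y in ball x r, |f y - ⨍ z in ball x r, f z ∂μ| ∂μ)
          / μ (ball x r)) = K := by
  have hfin : ∀ x r, 0 < r → μ (ball x r) < ⊤ := fun x r hr => (hμ x r hr).2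
  have := sigmaFinite_of_ball_lt_top hfin
  have hbdd : ∀ ρ : Measure M, (∀ x r, 0 < r → ρ (ball x r) < ⊤) →
      ∀ E : Set M, Bornology.IsBounded E → ρ E < ⊤ := by
    intro ρ hρ E hE
    rcases E.eq_empty_or_nonempty with rfl | ⟨x₀, -⟩
    · simp
    obtain ⟨R, hR, hER⟩ := hE.subset_ball_lt 0 x₀
    exact (measure_mono hER).trans_lt (hρ x₀ R hR)
  set w : M → ℝ → SignedMeasure M := fun x r =>
    (restrictSM ρ₁ (ball x r) - restrictSM ρ₂ (ball x r))
      - (((ρ₁ (ball x r)).toReal - (ρ₂ (ball x r)).toReal) / (μ (ball x r)).toReal) •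
        restrictSM μ (ball x r) with hw
  have hw_apply : ∀ x r, 0 < r → ∀ A, MeasurableSet A →
      w x r A = (ρ₁.real (A ∩ ball x r) - ρ₂.real (A ∩ ball x r))
        - (((ρ₁ (ball x r)).toReal - (ρ₂ (ball x r)).toReal) / (μ (ball x r)).toReal) *
          μ.real (A ∩ ball x r) := by
    intro x r hr A hA
    simp only [hw, sub_apply, smul_apply, smul_eq_mul,
      restrictSM_apply (hρ₁ x r hr) hA, restrictSM_apply (hρ₂ x r hr) hA,
      restrictSM_apply (hfin x r hr) hA]
  have hw_null : ∀ x r, 0 < r → ∀ A, MeasurableSet A → A ⊆ ball x r → μ A = 0 →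
      ‖ρ₁.real A - ρ₂.real A‖ₑ ≤ K * μ (ball x r) := by
    intro x r hr A hA hAB hA0
    have hwA := hw_apply x r hr A hA
    rw [Set.inter_eq_left.2 hAB, measureReal_def μ, hA0, toReal_zero, mul_zero, sub_zero] at hwA
    rw [← hwA]
    refine ((w x r).enorm_le_totalVariation A).trans ((measure_mono hAB).trans ?_)
    rw [← ENNReal.div_le_iff (hμ x r hr).1.ne' (hfin x r hr).ne, hK]
    exact le_iSup_of_le x (le_iSup_of_le r (le_iSup_of_le hr le_rfl))
  have hexcess : ∀ {ρ ρ' : Measure M} {A : Set M} {c : ℝ≥0∞}, ρ A < ⊤ → ρ' A < ⊤ →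
      ‖ρ.real A - ρ'.real A‖ₑ ≤ c → ρ A ≤ c + ρ' A := by
    intro ρ ρ' A c h h' hc
    calc ρ A = ENNReal.ofReal ((ρ.real A - ρ'.real A) + ρ'.real A) := by
          rw [sub_add_cancel, ofReal_measureReal h.ne]
      _ ≤ ENNReal.ofReal (ρ.real A - ρ'.real A) + ENNReal.ofReal (ρ'.real A) :=
          ENNReal.ofReal_add_le
      _ ≤ c + ρ' A := by
          rw [ofReal_measureReal h'.ne]
          gcongr
          exact (Real.ofReal_le_enorm _).trans hc
  have hnull : ∀ A, MeasurableSet A → Bornology.IsBounded A → μ A = 0 → ρ₁ A = ρ₂ A := by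
    intro A hA hAb hA0
    have h₁ := hbdd ρ₁ hρ₁ A hAb
    have h₂ := hbdd ρ₂ hρ₂ A hAb
    apply le_antisymm
    · refine measure_le_of_null_of_ball_le hμ ofReal_ne_top hdoub hKfin
        (fun x r hr t ht htB ht0 => ?_) hA hAb hA0 h₁ h₂
      exact hexcess ((measure_mono htB).trans_lt (hρ₁ x r hr))
        ((measure_mono htB).trans_lt (hρ₂ x r hr)) (hw_null x r hr t ht htB ht0)
    · refine measure_le_of_null_of_ball_le hμ ofReal_ne_top hdoub hKfin
        (fun x r hr t ht htB ht0 => ?_) hA hAb hA0 h₂ h₁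
      refine hexcess ((measure_mono htB).trans_lt (hρ₂ x r hr))
        ((measure_mono htB).trans_lt (hρ₁ x r hr)) ?_
      rw [← enorm_neg, neg_sub]
      exact hw_null x r hr t ht htB ht0
  set f : M → ℝ := fun x => (ρ₁.rnDeriv μ x).toReal - (ρ₂.rnDeriv μ x).toReal
  have hfB : ∀ x r, 0 < r → IntegrableOn f (ball x r) μ := fun x r hr =>
    (Measure.integrableOn_toReal_rnDeriv (hρ₁ x r hr).ne).sub
      (Measure.integrableOn_toReal_rnDeriv (hρ₂ x r hr).ne)
  have hrep : ∀ E : Set M, MeasurableSet E → Bornology.IsBounded E →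
      ρ₁.real E - ρ₂.real E = ∫ x in E, f x ∂μ := fun E hE hEb =>
    measureReal_sub_eq_setIntegral_rnDeriv_sub hE (hbdd ρ₁ hρ₁ E hEb).ne (hbdd ρ₂ hρ₂ E hEb).ne
      fun A hA hAE hA0 => hnull A hA (hEb.subset hAE) hA0
  refine ⟨f, fun x => ⟨ball x 1, ball_mem_nhds x one_pos, hfB x 1 one_pos⟩, hrep, ?_⟩
  rw [hK]
  refine iSup_congr fun x => iSup_congr fun r => iSup_congr fun hr => ?_
  congr 1
  change _ = (w x r).totalVariation (ball x r)
  set α := ⨍ z in ball x r, f z ∂μ with hα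
  have hα_eq : α = ((ρ₁ (ball x r)).toReal - (ρ₂ (ball x r)).toReal) / (μ (ball x r)).toReal := by
    rw [hα, setAverage_eq, ← hrep _ measurableSet_ball isBounded_ball, smul_eq_mul,
      div_eq_inv_mul]
    rfl
  have hconst : IntegrableOn (fun _ => α) (ball x r) μ := integrableOn_const (hfin x r hr).ne
  have hint : Integrable (fun y => f y - α) (μ.restrict (ball x r)) := (hfB x r hr).sub hconst
  have hw_density : w x r = (μ.restrict (ball x r)).withDensityᵥ (fun y => f y - α) := by
    ext A hA
    rw [hw_apply x r hr A hA, withDensityᵥ_apply hint hA, Measure.restrict_restrict hA,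
      integral_sub ((hfB x r hr).mono_set Set.inter_subset_right)
        (hconst.mono_set Set.inter_subset_right),
      ← hrep _ (hA.inter measurableSet_ball) (isBounded_ball.subset Set.inter_subset_right),
      setIntegral_const, smul_eq_mul, ← hα_eq, mul_comm α]
  rw [hw_density, SignedMeasure.totalVariation_eq_variation,
    Measure.variation_withDensityᵥ hint, withDensity_apply _ measurableSet_ball,
    Measure.restrict_restrict measurableSet_ball, Set.inter_self]
  exact ofReal_integral_norm_eq_lintegral_enorm hint
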